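/- arXiv:2302.06189 — 2 statements merged into one kernel-verified Lean document; each statement's English description precedes it below -/
import Mathlib

section
/- Assume conditions (V) and (AV1) hold. Let x ∈ D_I = D_ψ ∩ Λ be a critical point of I, i.e. dΦ(x)[z − x] + ψ(z) − ψ(x) ≥ 0 for all z ∈ X, where dΦ(x)[y] = ∫₀ᵀ ( −∇_x V(t,x(t))·y(t) + A(t,x(t))·ẏ(t) + ((D_x A(t,x(t)))ᵀ ẋ(t))·y(t) ) dt. Then |ẋ(t)| < c for every t ∈ [0,T], x is of class C¹ (with ẋ/√(1−|ẋ|²/c²) of class C¹), and x is a classical T-periodic solution of d/dt( ẋ / √(1 − |ẋ|²/c²) ) = −∇_x V(t,x) − ∂_t A(t,x) + ẋ × curl_x A(t,x). -/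
open Filter Topology Set MeasureTheory Function
open scoped ENNReal NNReal

noncomputable section

namespace LFE

/-- `ℝ³` with the Euclidean norm. -/
abbrev E3 : Type := EuclideanSpace ℝ (Fin 3)

def toFn (u : E3) : Fin 3 → ℝ := (WithLp.equiv 2 (Fin 3 → ℝ)) u

def fromFn (f : Fin 3 → ℝ) : E3 := (WithLp.equiv 2 (Fin 3 → ℝ)).symm f

/-- Euclidean inner product on `ℝ³`. -/
def dot (u v : E3) : ℝ := ∑ i, toFn u i * toFn v i

/-- Cross product on `ℝ³`. -/
def cross (u v : E3) : E3 :=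
  fromFn ![toFn u 1 * toFn v 2 - toFn u 2 * toFn v 1,
           toFn u 2 * toFn v 0 - toFn u 0 * toFn v 2,
           toFn u 0 * toFn v 1 - toFn u 1 * toFn v 0]

/-- Partial derivative `∂ᵢ Fⱼ` of a vector field on `ℝ³`. -/
def pd (F : E3 → E3) (x : E3) (i j : Fin 3) : ℝ :=
  toFn (fderiv ℝ F x (EuclideanSpace.single i 1)) j

/-- Curl of a vector field on `ℝ³`. -/
def curl (F : E3 → E3) (x : E3) : E3 :=
  fromFn ![pd F x 1 2 - pd F x 2 1, pd F x 2 0 - pd F x 0 2, pd F x 0 1 - pd F x 1 0]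

/-- Transpose of the Jacobian of `F` at `x`, applied to the vector `v`. -/
def jacT (F : E3 → E3) (x v : E3) : E3 :=
  fromFn fun i => dot (fderiv ℝ F x (EuclideanSpace.single i 1)) v

/-- The open set `Ω = {(t,x) : x ≠ rⱼ(t) for all j}`. -/
def Omega (N : ℕ) (r : Fin N → ℝ → E3) : Set (ℝ × E3) := {p | ∀ i, p.2 ≠ r i p.1}

/-- The basic setting: `T`-periodic `C¹` curves of singularities `r i`, moving slower than
light and never colliding, together with `C¹`, `T`-periodic (in time) potentials `V`, `A`
defined on `Ω`. -/
structure Setting (T c : ℝ) (N : ℕ) where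
  r : Fin N → ℝ → E3
  V : ℝ → E3 → ℝ
  A : ℝ → E3 → E3
  hT : 0 < T
  hc : 0 < c
  hr_per : ∀ i, Periodic (r i) T
  hr_C1 : ∀ i, ContDiff ℝ 1 (r i)
  hr_speed : ∀ i, ∃ b, b < c ∧ ∀ t, ‖deriv (r i) t‖ ≤ b
  hr_sep : ∀ i j, i ≠ j → ∀ t ∈ Icc (0:ℝ) T, r i t ≠ r j t
  hV_per : ∀ t x, V (t + T) x = V t x
  hA_per : ∀ t x, A (t + T) x = A t x
  hV_C1 : ContDiffOn ℝ 1 (fun p : ℝ × E3 => V p.1 p.2) (Omega N r)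
  hA_C1 : ContDiffOn ℝ 1 (fun p : ℝ × E3 => A p.1 p.2) (Omega N r)

variable {T c : ℝ} {N : ℕ}

/-- Condition (V): `V < 0` on `Ω` and `V` has a Keplerian blow-up at the singularities. -/
def CondV (S : Setting T c N) : Prop :=
  (∀ p ∈ Omega N S.r, S.V p.1 p.2 < 0) ∧
  ∃ κ > (0:ℝ), ∃ δ > (0:ℝ), ∀ i, ∀ p ∈ Omega N S.r,
    ‖p.2 - S.r i p.1‖ < δ → S.V p.1 p.2 ≤ -κ / ‖p.2 - S.r i p.1‖

/-- Condition (AV1): `|A| ≤ -(κ'/c) V` on `Ω` for some `κ' ∈ (0,1)`. -/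
def CondAV1 (S : Setting T c N) : Prop :=
  ∃ κ' : ℝ, 0 < κ' ∧ κ' < 1 ∧ ∀ p ∈ Omega N S.r, ‖S.A p.1 p.2‖ ≤ -(κ' / c) * S.V p.1 p.2

/-- Condition (AV2): `|V| + |∇ₓV + ∂ₜA| + |curlₓ A| → 0` as `|x| → ∞`, uniformly in `t`. -/
def CondAV2 (S : Setting T c N) : Prop :=
  ∀ ε > (0:ℝ), ∃ R : ℝ, ∀ p ∈ Omega N S.r, R < ‖p.2‖ →
    |S.V p.1 p.2| + ‖gradient (S.V p.1) p.2 + deriv (fun s => S.A s p.2) p.1‖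
      + ‖curl (S.A p.1) p.2‖ < ε

/-- `x` is a classical `T`-periodic solution of the Lorentz force equation
`d/dt (ẋ/√(1-|ẋ|²/c²)) = E(t,x) + ẋ × B(t,x)`, with
`E = -∇ₓV - ∂ₜA` and `B = curlₓ A`, avoiding the singularities. -/
def IsSolution (S : Setting T c N) (x : ℝ → E3) : Prop :=
  Periodic x T ∧ ContDiff ℝ 1 x ∧ (∀ t, (t, x t) ∈ Omega N S.r) ∧
  (∀ t, ‖deriv x t‖ < c) ∧
  ∀ t : ℝ, HasDerivAt (fun s => (Real.sqrt (1 - ‖deriv x s‖ ^ 2 / c ^ 2))⁻¹ • deriv x s)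
    (-(gradient (S.V t) (x t)) - deriv (fun s => S.A s (x t)) t
      + cross (deriv x t) (curl (S.A t) (x t))) t

/-- Membership in `X = {x ∈ W^{1,∞}(0,T;ℝ³) : x(0) = x(T)}`, identified with the space of
`T`-periodic Lipschitz paths. -/
def MemX (T : ℝ) (x : ℝ → E3) : Prop := Periodic x T ∧ ∃ K : ℝ≥0, LipschitzWith K x

/-- `‖x‖_∞` on `[0,T]`. -/
def supN (T : ℝ) (x : ℝ → E3) : ℝ := sSup ((fun t => ‖x t‖) '' Icc 0 T)

/-- `‖ẋ‖_∞` (essential supremum on `[0,T]`). -/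
def derN (T : ℝ) (x : ℝ → E3) : ℝ := (eLpNorm (deriv x) ⊤ (volume.restrict (Icc 0 T))).toReal

/-- The norm of `X`: `‖x‖ = ‖x‖_∞ + ‖ẋ‖_∞`. -/
def Xnorm (T : ℝ) (x : ℝ → E3) : ℝ := supN T x + derN T x

/-- Distance induced by the norm of `X`. -/
def Xdist (T : ℝ) (x y : ℝ → E3) : ℝ := Xnorm T (fun t => x t - y t)

/-- `D_ψ = {x ∈ X : ‖ẋ‖_∞ ≤ c}`, i.e. `x` is `c`-Lipschitz. -/
def MemDpsi (T c : ℝ) (x : ℝ → E3) : Prop := MemX T x ∧ LipschitzWith (Real.toNNReal c) x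

/-- The (finite part of the) kinetic functional `ψ`. -/
def psiVal (T c : ℝ) (x : ℝ → E3) : ℝ :=
  ∫ t in (0:ℝ)..T, c ^ 2 * (1 - Real.sqrt (1 - ‖deriv x t‖ ^ 2 / c ^ 2))

open Classical in
/-- The extended-real-valued functional `ψ`. -/
def psiE (T c : ℝ) (x : ℝ → E3) : EReal :=
  if MemDpsi T c x then (psiVal T c x : EReal) else ⊤

/-- `Λ = {x ∈ X : (t, x(t)) ∈ Ω for all t ∈ [0,T]}`. -/
def MemLambda (T : ℝ) {N : ℕ} (r : Fin N → ℝ → E3) (x : ℝ → E3) : Prop :=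
  MemX T x ∧ ∀ t ∈ Icc (0:ℝ) T, (t, x t) ∈ Omega N r

/-- The (finite part of the) potential functional `Φ`. -/
def phiVal (T : ℝ) (V : ℝ → E3 → ℝ) (A : ℝ → E3 → E3) (x : ℝ → E3) : ℝ :=
  ∫ t in (0:ℝ)..T, (-(V t (x t)) + dot (A t (x t)) (deriv x t))

open Classical in
/-- The extended-real-valued functional `Φ`. -/
def phiE (T : ℝ) {N : ℕ} (r : Fin N → ℝ → E3) (V : ℝ → E3 → ℝ) (A : ℝ → E3 → E3)
    (x : ℝ → E3) : EReal :=
  if MemLambda T r x then (phiVal T V A x : EReal) else ⊤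

/-- The action functional `I = ψ + Φ`. -/
def IE (T c : ℝ) {N : ℕ} (r : Fin N → ℝ → E3) (V : ℝ → E3 → ℝ) (A : ℝ → E3 → E3)
    (x : ℝ → E3) : EReal :=
  psiE T c x + phiE T r V A x

/-- The differential of `Φ` at `x ∈ Λ` in the direction `y`. -/
def dPhi (T : ℝ) (V : ℝ → E3 → ℝ) (A : ℝ → E3 → E3) (x y : ℝ → E3) : ℝ :=
  ∫ t in (0:ℝ)..T,
    (-(dot (gradient (V t) (x t)) (y t)) + dot (A t (x t)) (deriv y t)
      + dot (jacT (A t) (x t) (deriv x t)) (y t))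

end LFE

namespace LFE

section General

variable {E : Type*} [NormedAddCommGroup E]

lemma intervalIntegrable_of_norm_le {f : ℝ → E} {M : ℝ} (hf : AEStronglyMeasurable f volume)
    (hM : ∀ t, ‖f t‖ ≤ M) (a b : ℝ) : IntervalIntegrable f volume a b :=
  (intervalIntegrable_const (c := M)).mono_fun hf.restrict
    (ae_of_all _ fun t => (hM t).trans (le_abs_self M))

lemma locallyIntegrable_of_norm_le {f : ℝ → E} {M : ℝ} (hf : AEStronglyMeasurable f volume)
    (hM : ∀ t, ‖f t‖ ≤ M) : LocallyIntegrable f volume :=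
  (locallyIntegrable_const M).mono hf (ae_of_all _ fun t => (hM t).trans (le_abs_self M))

lemma periodic_norm_bounded {f : ℝ → E} {T : ℝ} (hT : 0 < T) (hf : Continuous f)
    (hp : Periodic f T) : ∃ M : ℝ, 0 ≤ M ∧ ∀ t, ‖f t‖ ≤ M := by
  obtain ⟨M, hM⟩ := (isCompact_Icc (a := (0 : ℝ)) (b := T)).exists_bound_of_continuousOn
    hf.continuousOn
  refine ⟨M, (norm_nonneg _).trans (hM 0 ⟨le_rfl, hT.le⟩), fun t => ?_⟩
  obtain ⟨s, hs, hst⟩ := hp.exists_mem_Ico₀ hT t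
  rw [hst]
  exact hM s ⟨hs.1, hs.2.le⟩

variable [NormedSpace ℝ E]

lemma deriv_periodic {f : ℝ → E} {T : ℝ} (hp : Periodic f T) : Periodic (deriv f) T := by
  intro t
  rw [← deriv_comp_add_const f T t]
  congr 1
  exact funext hp

lemma lipschitzWith_primitive [CompleteSpace E] {f : ℝ → E} {M : ℝ≥0}
    (hf : AEStronglyMeasurable f volume) (hM : ∀ t, ‖f t‖ ≤ M) :
    LipschitzWith M fun t => ∫ s in (0 : ℝ)..t, f s := by
  refine LipschitzWith.of_dist_le_mul fun s t => ?_
  rw [dist_eq_norm, intervalIntegral.integral_interval_sub_left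
    (intervalIntegrable_of_norm_le hf hM _ _) (intervalIntegrable_of_norm_le hf hM _ _),
    Real.dist_eq]
  exact intervalIntegral.norm_integral_le_of_norm_le_const fun u _ => hM u

lemma periodic_primitive [CompleteSpace E] {f : ℝ → E} {M T : ℝ}
    (hf : AEStronglyMeasurable f volume) (hM : ∀ t, ‖f t‖ ≤ M) (hp : Periodic f T)
    (h0 : ∫ s in (0 : ℝ)..T, f s = 0) : Periodic (fun t => ∫ s in (0 : ℝ)..t, f s) T := by
  intro t
  have h := hp.intervalIntegral_add_eq_add 0 t
    fun a b => intervalIntegrable_of_norm_le hf hM a b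
  simp only at h ⊢
  rw [h, zero_add, h0, add_zero]

end General

section Inner

variable {E : Type*} [NormedAddCommGroup E] [InnerProductSpace ℝ E]

/-- Integration by parts for Lipschitz paths. -/
lemma integral_inner_parts {F y f : ℝ → E} {K L : ℝ≥0} {T : ℝ} (hF : LipschitzWith K F)
    (hy : LipschitzWith L y) (hFf : ∀ᵐ t, HasDerivAt F (f t) t)
    (hyd : ∀ᵐ t, DifferentiableAt ℝ y t) :
    ∫ t in (0 : ℝ)..T, (inner ℝ (f t) (y t) + inner ℝ (F t) (deriv y t))
      = inner ℝ (F T) (y T) - inner ℝ (F 0) (y 0) := by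
  obtain ⟨a, ha⟩ := (isCompact_uIcc (a := (0 : ℝ)) (b := T)).exists_bound_of_continuousOn
    hF.continuous.continuousOn
  obtain ⟨b, hb⟩ := (isCompact_uIcc (a := (0 : ℝ)) (b := T)).exists_bound_of_continuousOn
    hy.continuous.continuousOn
  have hlip : LipschitzOnWith (a.toNNReal * L + K * b.toNNReal)
      (fun t => inner ℝ (F t) (y t)) (uIcc 0 T) := by
    refine LipschitzOnWith.of_dist_le_mul fun s hs t ht => ?_
    have h1 : inner ℝ (F s) (y s) - inner ℝ (F t) (y t)
        = inner ℝ (F s) (y s - y t) + inner ℝ (F s - F t) (y t) := by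
      rw [inner_sub_right, inner_sub_left]; ring
    rw [Real.dist_eq, h1]
    refine (abs_add_le _ _).trans ?_
    have h2 : |inner ℝ (F s) (y s - y t)| ≤ a.toNNReal * (L * dist s t) :=
      (abs_real_inner_le_norm _ _).trans (mul_le_mul
        ((ha s hs).trans (Real.le_coe_toNNReal a))
        (by rw [← dist_eq_norm]; exact hy.dist_le_mul s t) (norm_nonneg _) (NNReal.coe_nonneg _))
    have h3 : |inner ℝ (F s - F t) (y t)| ≤ (K * dist s t) * b.toNNReal :=
      (abs_real_inner_le_norm _ _).trans (mul_le_mul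
        (by rw [← dist_eq_norm]; exact hF.dist_le_mul s t)
        ((hb t ht).trans (Real.le_coe_toNNReal b)) (norm_nonneg _) (by positivity))
    push_cast
    linarith
  rw [← hlip.absolutelyContinuousOnInterval.integral_deriv_eq_sub]
  refine intervalIntegral.integral_congr_ae ?_
  filter_upwards [hFf, hyd] with t h1 h2 _
  rw [(h1.inner ℝ h2.hasDerivAt).deriv, add_comm]

/-- The inverse of the relativistic momentum map `v ↦ v / √(1 - |v|²/c²)`. -/
def velocity (c : ℝ) (u : E) : E := (c / √(c ^ 2 + ‖u‖ ^ 2)) • u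

lemma continuous_velocity {c : ℝ} (hc : 0 < c) : Continuous (velocity c : E → E) := by
  unfold velocity
  refine Continuous.smul (continuous_const.div (by fun_prop) fun u => ?_) continuous_id
  positivity

lemma sq_norm_velocity (c : ℝ) (u : E) :
    ‖velocity c u‖ ^ 2 = c ^ 2 * ‖u‖ ^ 2 / (c ^ 2 + ‖u‖ ^ 2) := by
  rw [velocity, norm_smul, mul_pow, Real.norm_eq_abs, sq_abs, div_pow,
    Real.sq_sqrt (by positivity)]
  ring

lemma norm_velocity_lt {c : ℝ} (hc : 0 < c) (u : E) : ‖velocity c u‖ < c := by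
  refine lt_of_pow_lt_pow_left₀ 2 hc.le ?_
  rw [sq_norm_velocity, div_lt_iff₀ (by positivity)]
  nlinarith [pow_pos hc 2, pow_pos hc 4]

lemma sqrt_one_sub_velocity {c : ℝ} (hc : 0 < c) (u : E) :
    √(1 - ‖velocity c u‖ ^ 2 / c ^ 2) = c / √(c ^ 2 + ‖u‖ ^ 2) := by
  have h : 1 - ‖velocity c u‖ ^ 2 / c ^ 2 = c ^ 2 / (c ^ 2 + ‖u‖ ^ 2) := by
    have : c ^ 2 + ‖u‖ ^ 2 ≠ 0 := by positivity
    rw [sq_norm_velocity]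
    field_simp
    ring
  rw [h, Real.sqrt_div (by positivity), Real.sqrt_sq hc.le]

lemma momentum_velocity {c : ℝ} (hc : 0 < c) (u : E) :
    (√(1 - ‖velocity c u‖ ^ 2 / c ^ 2))⁻¹ • velocity c u = u := by
  rw [sqrt_one_sub_velocity hc, velocity, smul_smul, inv_mul_cancel₀, one_smul]
  positivity

/-- Quantitative strict minimality of `velocity c u` for the Legendre transform of the
relativistic Lagrangian. -/
lemma half_sq_norm_sub_velocity_le {c : ℝ} (hc : 0 < c) (u : E) {v : E} (hv : ‖v‖ ≤ c) :
    ‖v - velocity c u‖ ^ 2 / 2 ≤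
      c ^ 2 * (1 - √(1 - ‖v‖ ^ 2 / c ^ 2))
        - c ^ 2 * (1 - √(1 - ‖velocity c u‖ ^ 2 / c ^ 2)) - inner ℝ u (v - velocity c u) := by
  rw [sqrt_one_sub_velocity hc, inner_sub_right, norm_sub_sq_real, sq_norm_velocity]
  set R := √(c ^ 2 + ‖u‖ ^ 2) with hR
  have hR2 : R ^ 2 = c ^ 2 + ‖u‖ ^ 2 := Real.sq_sqrt (by positivity)
  have hRc : c ≤ R := by
    refine Real.le_sqrt_of_sq_le ?_
    nlinarith [sq_nonneg ‖u‖]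
  have hR0 : 0 < R := hc.trans_le hRc
  set s := √(1 - ‖v‖ ^ 2 / c ^ 2) with hs
  have hv1 : 0 ≤ 1 - ‖v‖ ^ 2 / c ^ 2 := by
    rw [sub_nonneg, div_le_one (by positivity)]
    exact pow_le_pow_left₀ (norm_nonneg _) hv 2
  have hs2 : ‖v‖ ^ 2 = c ^ 2 * (1 - s ^ 2) := by
    rw [hs, Real.sq_sqrt hv1]; field_simp; ring
  rw [velocity, ← hR, real_inner_smul_right, real_inner_smul_right, real_inner_self_eq_norm_sq,
    real_inner_comm u v]
  set a := inner ℝ u v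
  have hu2 : ‖u‖ ^ 2 = R ^ 2 - c ^ 2 := by linarith
  rw [← hR2, hs2, hu2]
  have key : c ^ 2 * (1 - s ^ 2) - 2 * (c / R * a) + c ^ 2 * (R ^ 2 - c ^ 2) / R ^ 2
      + (c * s - c * (c / R)) ^ 2 = 2 * (c / R) * (c * R - a - c ^ 2 * s) := by
    field_simp
    ring
  have hD : c ^ 2 * (1 - s) - c ^ 2 * (1 - c / R) - (a - c / R * (R ^ 2 - c ^ 2))
      = c * R - a - c ^ 2 * s := by
    field_simp
    ring
  rw [hD]
  have hN : 0 ≤ c ^ 2 * (1 - s ^ 2) - 2 * (c / R * a) + c ^ 2 * (R ^ 2 - c ^ 2) / R ^ 2 := by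
    have h := sq_nonneg ‖v - velocity c u‖
    rw [norm_sub_sq_real, sq_norm_velocity, velocity, ← hR, real_inner_smul_right,
      real_inner_comm u v, ← hR2, hs2, hu2] at h
    exact h
  have hq := sq_nonneg (c * s - c * (c / R))
  have hcR : c / R ≤ 1 := (div_le_one hR0).2 hRc
  have hcR0 : 0 < c / R := by positivity
  have hD0 : 0 ≤ c * R - a - c ^ 2 * s := by
    by_contra hneg
    push Not at hneg
    nlinarith
  nlinarith [mul_le_mul_of_nonneg_right hcR hD0]

/-- The average of `velocity c (l - w t)` can be made to vanish by a suitable choice of `l`. -/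
lemma exists_integral_velocity_eq_zero [FiniteDimensional ℝ E] {c T : ℝ} (hc : 0 < c)
    (hT : 0 < T) {w : ℝ → E} (hw : Continuous w) :
    ∃ l : E, ∫ t in (0 : ℝ)..T, velocity c (l - w t) = 0 := by
  have : CompleteSpace E := FiniteDimensional.complete ℝ E
  have : ProperSpace E := FiniteDimensional.proper ℝ E
  set h : E → ℝ := fun l => ∫ t in (0 : ℝ)..T, √(c ^ 2 + ‖l - w t‖ ^ 2) with hh
  have hcont : Continuous h := by
    refine intervalIntegral.continuous_parametric_intervalIntegral_of_continuous' ?_ 0 T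
    fun_prop
  have hint : ∀ l, IntervalIntegrable (fun t => √(c ^ 2 + ‖l - w t‖ ^ 2)) volume 0 T :=
    fun l => (by fun_prop : Continuous _).intervalIntegrable _ _
  have hlow : ∀ l, T * ‖l‖ - (∫ t in (0 : ℝ)..T, ‖w t‖) ≤ h l := by
    intro l
    have h1 : T * ‖l‖ - (∫ t in (0 : ℝ)..T, ‖w t‖) = ∫ t in (0 : ℝ)..T, (‖l‖ - ‖w t‖) := by
      rw [intervalIntegral.integral_sub intervalIntegrable_const
        (hw.norm.intervalIntegrable _ _)]
      simp
    rw [h1]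
    refine intervalIntegral.integral_mono_on hT.le
      ((by fun_prop : Continuous _).intervalIntegrable _ _) (hint l) fun t _ => ?_
    refine (norm_sub_norm_le _ _).trans (Real.le_sqrt_of_sq_le ?_)
    nlinarith [sq_nonneg c]
  have hlim : Tendsto h (cocompact E) atTop := by
    refine tendsto_atTop_mono hlow (tendsto_atTop_add_const_right _ _ ?_)
    exact tendsto_norm_cocompact_atTop.const_mul_atTop hT
  obtain ⟨l, hl⟩ := hcont.exists_forall_le hlim
  refine ⟨l, ?_⟩
  set m := ∫ t in (0 : ℝ)..T, velocity c (l - w t) with hm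
  have hvc : Continuous fun t => velocity c (l - w t) :=
    (continuous_velocity hc).comp (by fun_prop)
  have hup : ∀ k : E, 0 ≤ inner ℝ k m + T * (‖k‖ ^ 2 / 2) := by
    intro k
    have hpt : ∀ t, c * √(c ^ 2 + ‖l + k - w t‖ ^ 2) ≤
        c * √(c ^ 2 + ‖l - w t‖ ^ 2) + (inner ℝ k (velocity c (l - w t)) + ‖k‖ ^ 2 / 2) := by
      intro t
      rw [velocity, real_inner_smul_right]
      have e : l + k - w t = (l - w t) + k := by abel
      rw [e, norm_add_sq_real]
      set u := l - w t
      set R := √(c ^ 2 + ‖u‖ ^ 2) with hR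
      have hR2 : R ^ 2 = c ^ 2 + ‖u‖ ^ 2 := Real.sq_sqrt (by positivity)
      have hRc : c ≤ R := by
        refine Real.le_sqrt_of_sq_le ?_
        nlinarith [sq_nonneg ‖u‖]
      have hR0 : 0 < R := hc.trans_le hRc
      rw [real_inner_comm k u]
      set a := inner ℝ k u
      have h3 : 0 ≤ c ^ 2 + (‖u‖ ^ 2 + 2 * a + ‖k‖ ^ 2) := by
        have := sq_nonneg ‖u + k‖
        rw [norm_add_sq_real, real_inner_comm] at this
        nlinarith [sq_nonneg c]
      set Q := √(c ^ 2 + (‖u‖ ^ 2 + 2 * a + ‖k‖ ^ 2)) with hQ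
      have hQ2 : Q ^ 2 = R ^ 2 + 2 * a + ‖k‖ ^ 2 := by
        rw [hQ, Real.sq_sqrt h3, hR2]; ring
      have h4 : Q ≤ R + (2 * a + ‖k‖ ^ 2) / (2 * R) := by
        have : R + (2 * a + ‖k‖ ^ 2) / (2 * R) - Q = (Q - R) ^ 2 / (2 * R) := by
          have : 2 * a + ‖k‖ ^ 2 = Q ^ 2 - R ^ 2 := by linarith
          rw [this]; field_simp; ring
        have : 0 ≤ (Q - R) ^ 2 / (2 * R) := by positivity
        linarith
      have h5 : c * ((2 * a + ‖k‖ ^ 2) / (2 * R)) = c / R * a + c / R * (‖k‖ ^ 2 / 2) := by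
        field_simp
      have hcR : c / R ≤ 1 := (div_le_one hR0).2 hRc
      nlinarith [mul_le_mul_of_nonneg_left h4 hc.le, sq_nonneg ‖k‖]
    have hik : Continuous fun t => inner ℝ k (velocity c (l - w t)) :=
      continuous_const.inner hvc
    have hik2 : Continuous fun t => inner ℝ k (velocity c (l - w t)) + ‖k‖ ^ 2 / 2 :=
      hik.add continuous_const
    have hmono := intervalIntegral.integral_mono_on (μ := volume) hT.le
      ((hint (l + k)).const_mul c)
      (((hint l).const_mul c).add (hik2.intervalIntegrable 0 T)) fun t _ => hpt t
    rw [intervalIntegral.integral_add ((hint l).const_mul c) (hik2.intervalIntegrable 0 T),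
      intervalIntegral.integral_add (hik.intervalIntegrable 0 T) intervalIntegrable_const,
      intervalIntegral.integral_const_mul, intervalIntegral.integral_const_mul,
      intervalIntegral.integral_const, sub_zero, smul_eq_mul] at hmono
    have hcomm : ∫ t in (0 : ℝ)..T, inner ℝ k (velocity c (l - w t)) = inner ℝ k m :=
      (innerSL ℝ k).intervalIntegral_comp_comm (hvc.intervalIntegrable 0 T)
    rw [hcomm] at hmono
    have := mul_le_mul_of_nonneg_left (hl (l + k)) hc.le
    linarith
  have hk := hup (-(T⁻¹ • m))
  rw [inner_neg_left, real_inner_smul_left, real_inner_self_eq_norm_sq, norm_neg, norm_smul,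
    mul_pow, norm_inv, Real.norm_of_nonneg hT.le] at hk
  have e : -(T⁻¹ * ‖m‖ ^ 2) + T * (T⁻¹ ^ 2 * ‖m‖ ^ 2 / 2) = -(T⁻¹ * ‖m‖ ^ 2 / 2) := by
    field_simp
    ring
  rw [e] at hk
  have hm0 : ‖m‖ ^ 2 ≤ 0 := by
    have := inv_pos.2 hT
    by_contra hcon
    push Not at hcon
    nlinarith [mul_pos this hcon]
  exact norm_eq_zero.1 (pow_eq_zero_iff (two_ne_zero) |>.1 (le_antisymm hm0 (sq_nonneg _)))

end Inner

lemma dot_eq_inner (u v : E3) : dot u v = inner ℝ u v := by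
  simp [dot, toFn, PiLp.inner_apply, mul_comm]

lemma abs_kinetic_le {c : ℝ} (v : E3) :
    ‖c ^ 2 * (1 - √(1 - ‖v‖ ^ 2 / c ^ 2))‖ ≤ c ^ 2 := by
  have h1 : √(1 - ‖v‖ ^ 2 / c ^ 2) ≤ 1 := by
    refine Real.sqrt_le_one.2 ?_
    have : 0 ≤ ‖v‖ ^ 2 / c ^ 2 := by positivity
    linarith
  have h0 := Real.sqrt_nonneg (1 - ‖v‖ ^ 2 / c ^ 2)
  rw [Real.norm_eq_abs, abs_of_nonneg (mul_nonneg (sq_nonneg c) (by linarith))]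
  nlinarith [sq_nonneg c]

lemma intervalIntegrable_kinetic (c a b : ℝ) (y : ℝ → E3) :
    IntervalIntegrable (fun t => c ^ 2 * (1 - √(1 - ‖deriv y t‖ ^ 2 / c ^ 2))) volume a b := by
  refine intervalIntegrable_of_norm_le ?_ (fun t => abs_kinetic_le (deriv y t)) a b
  have := measurable_deriv y
  exact Measurable.aestronglyMeasurable (by fun_prop)

/-- Two periodic Lipschitz paths with the same initial value and almost everywhere the same
derivative on a period agree. -/
lemma eq_of_ae_deriv_eq {E : Type*} [NormedAddCommGroup E] [NormedSpace ℝ E]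
    [FiniteDimensional ℝ E] {x z : ℝ → E} {K L : ℝ≥0} {T : ℝ} (hT : 0 < T)
    (hx : LipschitzWith K x) (hz : LipschitzWith L z) (hxp : Periodic x T) (hzp : Periodic z T)
    (h0 : x 0 = z 0) (hd : ∀ᵐ t, t ∈ Ioc 0 T → deriv x t = deriv z t) : x = z := by
  have hac : AbsolutelyContinuousOnInterval (fun t => x t - z t) 0 T :=
    (hx.sub hz).lipschitzOnWith.absolutelyContinuousOnInterval
  have hne : ∀ᵐ t : ℝ, t ≠ 0 := by simp [ae_iff]
  obtain ⟨C, hC⟩ := hac.const_of_ae_hasDerivAt_zero (by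
    filter_upwards [hd, hx.ae_differentiableAt_real, hz.ae_differentiableAt_real, hne]
      with t h1 h2 h3 h4 ht
    rw [uIcc_of_le hT.le] at ht
    have := h2.hasDerivAt.sub h3.hasDerivAt
    rwa [h1 ⟨lt_of_le_of_ne ht.1 h4.symm, ht.2⟩, sub_self] at this)
  rw [uIcc_of_le hT.le] at hC
  have hC0 : C = 0 := by rw [← hC 0 ⟨le_rfl, hT.le⟩, h0, sub_self]
  funext t
  obtain ⟨s, hs, hst⟩ := (hxp.sub hzp).exists_mem_Ico₀ hT t
  have := hC s ⟨hs.1, hs.2.le⟩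
  simp only [Pi.sub_apply] at hst
  rw [← sub_eq_zero, hst, this, hC0]

/-- Abstract regularity: a critical point of the kinetic functional perturbed by the linear form
`y ↦ ∫ f·y + q·ẏ` has momentum `l - q + ∫ f`. -/
lemma exists_hasDerivAt_velocity {T c M : ℝ} (hT : 0 < T) (hc : 0 < c) {x f q : ℝ → E3}
    (hx : MemDpsi T c x) (hfm : AEStronglyMeasurable f volume) (hfM : ∀ t, ‖f t‖ ≤ M)
    (hfp : Periodic f T) (hq : Continuous q) (hqp : Periodic q T)
    (hcrit : ∀ z : ℝ → E3, MemDpsi T c z →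
      0 ≤ (∫ t in (0 : ℝ)..T, (inner ℝ (f t) (z t - x t)
        + inner ℝ (q t) (deriv (fun t => z t - x t) t))) + psiVal T c z - psiVal T c x) :
    ∃ l : E3, ∀ t, HasDerivAt x (velocity c (l + (∫ s in (0 : ℝ)..t, f s) - q t)) t := by
  obtain ⟨⟨hxp, -⟩, hxL⟩ := hx
  have hfi : ∀ a b, IntervalIntegrable f volume a b := intervalIntegrable_of_norm_le hfm hfM
  have hM0 : 0 ≤ M := (norm_nonneg _).trans (hfM 0)
  lift M to ℝ≥0 using hM0
  have hF0 : ∫ s in (0 : ℝ)..T, f s = 0 := by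
    set e := ∫ s in (0 : ℝ)..T, f s with he
    have h := hcrit (fun t => x t + -e) ⟨⟨fun t => by simp only [hxp t], _,
      hxL.add (LipschitzWith.const (-e))⟩, by simpa using hxL.add (LipschitzWith.const (-e))⟩
    have h1 : psiVal T c (fun t => x t + -e) = psiVal T c x := by
      simp only [psiVal, deriv_add_const]
    rw [h1] at h
    simp only [add_sub_cancel_left, deriv_const, inner_zero_right, add_zero, add_sub_cancel_right]
      at h
    have h2 : ∫ t in (0 : ℝ)..T, inner ℝ (f t) (-e) = inner ℝ (-e) e := by
      simp only [real_inner_comm (-e)]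
      exact (innerSL ℝ (-e)).intervalIntegral_comp_comm (hfi 0 T)
    rw [h2, inner_neg_left, real_inner_self_eq_norm_sq] at h
    have : ‖e‖ ^ 2 = 0 := le_antisymm (by linarith) (sq_nonneg _)
    exact norm_eq_zero.1 ((pow_eq_zero_iff two_ne_zero).1 this)
  set F : ℝ → E3 := fun t => ∫ s in (0 : ℝ)..t, f s with hF
  have hFL : LipschitzWith M F := lipschitzWith_primitive hfm hfM
  have hFp : Periodic F T := periodic_primitive hfm hfM hfp hF0
  have hFd : ∀ᵐ t, HasDerivAt F (f t) t := by
    filter_upwards [LocallyIntegrable.ae_hasDerivAt_integral (locallyIntegrable_of_norm_le hfm hfM)] with t ht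
      using ht 0
  obtain ⟨l, hl⟩ := exists_integral_velocity_eq_zero hc hT (hq.sub hFL.continuous)
  have hul : ∀ t, l - (q t - F t) = l + F t - q t := fun t => by abel
  simp only [Pi.sub_apply, hul] at hl
  set p : ℝ → E3 := fun t => velocity c (l + F t - q t) with hp
  have hpc : Continuous p := (continuous_velocity hc).comp
    ((continuous_const.add hFL.continuous).sub hq)
  have hpp : Periodic p T := fun t => by simp only [hp, hFp t, hqp t]
  have hpn : ∀ t, ‖p t‖ ≤ c.toNNReal := fun t => by
    rw [Real.coe_toNNReal c hc.le]; exact (norm_velocity_lt hc _).le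
  set z : ℝ → E3 := fun t => x 0 + ∫ s in (0 : ℝ)..t, p s with hz
  have hzd : ∀ t, HasDerivAt z (p t) t := fun t =>
    (hpc.integral_hasStrictDerivAt 0 t).hasDerivAt.const_add _
  have hzL : LipschitzWith c.toNNReal z := by
    simpa using (LipschitzWith.const (x 0)).add
      (lipschitzWith_primitive hpc.aestronglyMeasurable hpn)
  have hzp : Periodic z T := fun t => by
    simp only [hz, periodic_primitive hpc.aestronglyMeasurable hpn hpp hl t]
  have hz0 : x 0 = z 0 := by simp [hz]
  refine ⟨l, ?_⟩
  suffices hxz : x = z by rw [hxz]; exact hzd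
  have hyL := hzL.sub hxL
  have hxD := hxL.ae_differentiableAt_real
  have hyD : ∀ᵐ t, DifferentiableAt ℝ (fun t => z t - x t) t := by
    filter_upwards [hxD] with t ht using (hzd t).differentiableAt.sub ht
  have hparts := integral_inner_parts (T := T) (F := fun t => l + F t)
    ((LipschitzWith.const l).add hFL) hyL (by
      filter_upwards [hFd] with t ht using ht.const_add l) hyD
  have hyT : z T - x T = 0 := by
    rw [← zero_add T, hzp 0, hxp 0, hz0, sub_self]
  have hy0 : z 0 - x 0 = 0 := by rw [hz0, sub_self]
  rw [hyT, hy0, inner_zero_right, inner_zero_right, sub_zero] at hparts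
  have h := hcrit z ⟨⟨hzp, _, hzL⟩, hzL⟩
  have hxn : ∀ t, ‖deriv x t‖ ≤ c := fun t => by
    simpa [hc.le] using norm_deriv_le_of_lipschitz hxL (x₀ := t)
  have hym := (measurable_deriv (fun t => z t - x t))
  have hdyn : ∀ t, ‖deriv (fun t => z t - x t) t‖ ≤ (c.toNNReal + c.toNNReal : ℝ≥0) :=
    fun t => norm_deriv_le_of_lipschitz hyL
  have hyi : ∀ g : ℝ → E3, Continuous g →
      IntervalIntegrable (fun t => inner ℝ (g t) (deriv (fun t => z t - x t) t)) volume 0 T := by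
    intro g hg
    obtain ⟨a, ha⟩ := (isCompact_uIcc (a := (0 : ℝ)) (b := T)).exists_bound_of_continuousOn
      hg.continuousOn
    refine (intervalIntegrable_const (c := a * (c.toNNReal + c.toNNReal : ℝ≥0))).mono_fun
      (hg.aestronglyMeasurable.inner hym.aestronglyMeasurable).restrict ?_
    refine (ae_restrict_iff' measurableSet_uIoc).2 (ae_of_all _ fun t ht => ?_)
    have hat := ha t (uIoc_subset_uIcc ht)
    exact ((norm_inner_le_norm _ _).trans (mul_le_mul hat (hdyn t) (norm_nonneg _)
      ((norm_nonneg _).trans hat))).trans (le_abs_self _)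
  have hfyi : IntervalIntegrable (fun t => inner ℝ (f t) (z t - x t)) volume 0 T := by
    obtain ⟨a, ha0, ha⟩ := periodic_norm_bounded hT hyL.continuous (hzp.sub hxp)
    exact intervalIntegrable_of_norm_le (M := M * a)
      (hfm.inner hyL.continuous.aestronglyMeasurable) (fun t => (norm_inner_le_norm _ _).trans
      (mul_le_mul (hfM t) (ha t) (norm_nonneg _) (NNReal.coe_nonneg _))) 0 T
  have hi1 := hfyi.add (hyi q hq)
  have hi2 := hfyi.add (hyi (fun t => l + F t) (continuous_const.add hFL.continuous))
  have hkz := intervalIntegrable_kinetic c 0 T z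
  have hkx := intervalIntegrable_kinetic c 0 T x
  have hsq : IntervalIntegrable (fun t => ‖deriv x t - p t‖ ^ 2 / 2) volume 0 T := by
    refine intervalIntegrable_of_norm_le (M := (c + c) ^ 2 / 2) ?_ (fun t => ?_) 0 T
    · have h1 := measurable_deriv x
      have h2 := hpc.measurable
      exact Measurable.aestronglyMeasurable (by fun_prop)
    · rw [Real.norm_of_nonneg (by positivity)]
      have : ‖deriv x t - p t‖ ≤ c + c :=
        (norm_sub_le _ _).trans (add_le_add (hxn t) (norm_velocity_lt hc _).le)
      gcongr
  have hle : ∫ t in (0 : ℝ)..T, ‖deriv x t - p t‖ ^ 2 / 2 ≤ 0 := by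
    have hmono := intervalIntegral.integral_mono_ae hT.le hsq
      (((hi2.sub hi1).add hkx).sub hkz) (by
        filter_upwards [hxD] with t ht
        have hk := half_sq_norm_sub_velocity_le hc (l + F t - q t) (hxn t)
        have hdy : deriv (fun t => z t - x t) t = p t - deriv x t :=
          ((hzd t).sub ht.hasDerivAt).deriv
        simp only [hdy, (hzd t).deriv]
        refine hk.trans (le_of_eq ?_)
        simp only [inner_sub_left, inner_sub_right, hp]
        ring)
    rw [intervalIntegral.integral_sub ((hi2.sub hi1).add hkx) hkz,
      intervalIntegral.integral_add (hi2.sub hi1) hkx,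
      intervalIntegral.integral_sub hi2 hi1, hparts] at hmono
    unfold psiVal at h
    linarith
  have hzero := (intervalIntegral.integral_eq_zero_iff_of_le_of_nonneg_ae hT.le
    (ae_of_all _ fun t => by positivity) hsq).1
    (le_antisymm hle (intervalIntegral.integral_nonneg hT.le fun t _ => by positivity))
  refine eq_of_ae_deriv_eq hT hxL hzL hxp hzp hz0 ?_
  rw [Filter.EventuallyEq, ae_restrict_iff' measurableSet_Ioc] at hzero
  filter_upwards [hzero] with t ht hmem
  rw [(hzd t).deriv, ← sub_eq_zero, ← norm_eq_zero]
  have := ht hmem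
  simp only [Pi.zero_apply] at this
  exact (pow_eq_zero_iff two_ne_zero).1 (by linarith)

lemma jacT_eq_adjoint (F : E3 → E3) (a v : E3) :
    jacT F a v = ContinuousLinearMap.adjoint (fderiv ℝ F a) v := by
  ext i
  have h : (ContinuousLinearMap.adjoint (fderiv ℝ F a) v) i
      = inner ℝ (EuclideanSpace.single i (1 : ℝ)) (ContinuousLinearMap.adjoint (fderiv ℝ F a) v) := by
    simp [EuclideanSpace.inner_single_left]
  rw [h, ContinuousLinearMap.adjoint_inner_right, ← dot_eq_inner]
  rfl

/-- `v × curl F = (DF)ᵀ v - (DF) v`. -/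
lemma cross_curl (F : E3 → E3) (a v : E3) :
    cross v (curl F a) = jacT F a v - fderiv ℝ F a v := by
  have hv : v = ∑ i, v i • EuclideanSpace.single i (1 : ℝ) := by
    ext j
    fin_cases j <;> simp [Fin.sum_univ_three]
  have hF : fderiv ℝ F a v = ∑ i, v i • fderiv ℝ F a (EuclideanSpace.single i 1) := by
    conv_lhs => rw [hv]
    simp only [map_sum, map_smul]
  ext j
  rw [hF]
  fin_cases j <;>
    simp [cross, curl, jacT, dot, pd, toFn, fromFn, Fin.sum_univ_three] <;> ring

lemma isOpen_Omega {N : ℕ} {r : Fin N → ℝ → E3} (hr : ∀ i, Continuous (r i)) :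
    IsOpen (Omega N r) := by
  have : Omega N r = ⋂ i, {p : ℝ × E3 | p.2 ≠ r i p.1} := by
    ext p; simp [Omega]
  rw [this]
  exact isOpen_iInter_of_finite fun i =>
    isOpen_ne_fun continuous_snd ((hr i).comp continuous_fst)

lemma fderiv_snd_slice {G : Type*} [NormedAddCommGroup G] [NormedSpace ℝ G]
    {B : ℝ → E3 → G} {t : ℝ} {a : E3}
    (h : DifferentiableAt ℝ (fun p : ℝ × E3 => B p.1 p.2) (t, a)) :
    fderiv ℝ (B t) a = (fderiv ℝ (fun p : ℝ × E3 => B p.1 p.2) (t, a)).comp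
      (ContinuousLinearMap.inr ℝ ℝ E3) :=
  (h.hasFDerivAt.comp a (hasFDerivAt_prodMk_right t a)).fderiv

lemma hasDerivAt_along {G : Type*} [NormedAddCommGroup G] [NormedSpace ℝ G]
    {B : ℝ → E3 → G} {t : ℝ} {x : ℝ → E3} {v : E3}
    (h : DifferentiableAt ℝ (fun p : ℝ × E3 => B p.1 p.2) (t, x t)) (hx : HasDerivAt x v t) :
    HasDerivAt (fun s => B s (x s))
      (fderiv ℝ (fun p : ℝ × E3 => B p.1 p.2) (t, x t) (1, v)) t :=
  HasFDerivAt.comp_hasDerivAt (f := fun s => (s, x s)) t h.hasFDerivAt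
    ((hasDerivAt_id' t).prodMk hx)

lemma fderiv_along_eq {G : Type*} [NormedAddCommGroup G] [NormedSpace ℝ G]
    {B : ℝ → E3 → G} {t : ℝ} {a v : E3}
    (h : DifferentiableAt ℝ (fun p : ℝ × E3 => B p.1 p.2) (t, a)) :
    fderiv ℝ (fun p : ℝ × E3 => B p.1 p.2) (t, a) (1, v)
      = deriv (fun s => B s a) t + fderiv ℝ (B t) a v := by
  rw [fderiv_snd_slice h, (hasDerivAt_along (x := fun _ => a) h (hasDerivAt_const t a)).deriv,
    ContinuousLinearMap.comp_apply, ← map_add]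
  simp

lemma mem_Omega_of_periodic {T c : ℝ} {N : ℕ} (S : Setting T c N) {x : ℝ → E3}
    (hxp : Periodic x T) (hx : ∀ t ∈ Icc (0 : ℝ) T, (t, x t) ∈ Omega N S.r) (t : ℝ) :
    (t, x t) ∈ Omega N S.r := by
  intro i
  obtain ⟨s, hs, hst⟩ := (hxp.sub (S.hr_per i)).exists_mem_Ico₀ S.hT t
  have h := hx s ⟨hs.1, hs.2.le⟩ i
  simp only [Pi.sub_apply] at hst
  rw [← sub_ne_zero] at h ⊢
  simp only at h ⊢
  rwa [hst]

end LFE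

/-- **Lemma (regularity of critical points).** Under (V) and (AV1), every critical point
`x ∈ D_I` of `I` satisfies `|ẋ(t)| < c`, is of class `C¹` together with its relativistic
momentum, and is a classical `T`-periodic solution of
`d/dt(ẋ/√(1-|ẋ|²/c²)) = -∇ₓV - ∂ₜA + ẋ × curlₓA`. -/
theorem critical_points_are_classical_solutions
    {T c : ℝ} {N : ℕ} (S : LFE.Setting T c N)
    (hV : LFE.CondV S) (hAV1 : LFE.CondAV1 S)
    (x : ℝ → LFE.E3) (hx1 : LFE.MemDpsi T c x) (hx2 : LFE.MemLambda T S.r x)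
    (hcrit : ∀ z : ℝ → LFE.E3, LFE.MemDpsi T c z →
      0 ≤ LFE.dPhi T S.V S.A x (fun t => z t - x t) + LFE.psiVal T c z - LFE.psiVal T c x) :
    (∀ t ∈ Set.Icc (0:ℝ) T, ‖deriv x t‖ < c) ∧
    ContDiff ℝ 1 x ∧
    ContDiff ℝ 1 (fun s => (Real.sqrt (1 - ‖deriv x s‖ ^ 2 / c ^ 2))⁻¹ • deriv x s) ∧
    ∀ t : ℝ, HasDerivAt (fun s => (Real.sqrt (1 - ‖deriv x s‖ ^ 2 / c ^ 2))⁻¹ • deriv x s)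
      (-(gradient (S.V t) (x t)) - deriv (fun s => S.A s (x t)) t
        + LFE.cross (deriv x t) (LFE.curl (S.A t) (x t))) t := by
  have hT := S.hT
  have hc := S.hc
  have hxp : Periodic x T := hx1.1.1
  have hxL := hx1.2
  have hxΩ := LFE.mem_Omega_of_periodic S hxp hx2.2
  have hΩ := LFE.isOpen_Omega fun i => (S.hr_C1 i).continuous
  set DV := fderiv ℝ (fun p : ℝ × LFE.E3 => S.V p.1 p.2)
  set DA := fderiv ℝ (fun p : ℝ × LFE.E3 => S.A p.1 p.2) with hDA
  have hVd : ∀ t, DifferentiableAt ℝ (fun p : ℝ × LFE.E3 => S.V p.1 p.2) (t, x t) := fun t =>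
    (S.hV_C1.contDiffAt (hΩ.mem_nhds (hxΩ t))).differentiableAt one_ne_zero
  have hAd : ∀ t, DifferentiableAt ℝ (fun p : ℝ × LFE.E3 => S.A p.1 p.2) (t, x t) := fun t =>
    (S.hA_C1.contDiffAt (hΩ.mem_nhds (hxΩ t))).differentiableAt one_ne_zero
  have hpath : Continuous fun t => (t, x t) := continuous_id.prodMk hxL.continuous
  have hDVc : Continuous fun t => DV (t, x t) :=
    (S.hV_C1.continuousOn_fderiv_of_isOpen hΩ le_rfl).comp_continuous hpath hxΩ
  have hDAc : Continuous fun t => DA (t, x t) :=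
    (S.hA_C1.continuousOn_fderiv_of_isOpen hΩ le_rfl).comp_continuous hpath hxΩ
  have hVp : Periodic S.V T := fun t => funext (S.hV_per t)
  have hAp : Periodic S.A T := fun t => funext (S.hA_per t)
  set g : ℝ → LFE.E3 := fun t => gradient (S.V t) (x t) with hg
  have hgc : Continuous g := by
    simp only [hg, gradient, LFE.fderiv_snd_slice (hVd _)]
    exact (LinearIsometryEquiv.continuous _).comp (hDVc.clm_comp continuous_const)
  have hgp : Periodic g T := fun t => by simp only [hg, hVp t, hxp t]
  set J : ℝ → (LFE.E3 →L[ℝ] LFE.E3) := fun t =>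
    ContinuousLinearMap.adjoint (fderiv ℝ (S.A t) (x t)) with hJ
  have hJc : Continuous J := by
    simp only [hJ, LFE.fderiv_snd_slice (hAd _)]
    exact (LinearIsometryEquiv.continuous _).comp (hDAc.clm_comp continuous_const)
  have hJp : Periodic J T := fun t => by simp only [hJ, hAp t, hxp t]
  set q : ℝ → LFE.E3 := fun t => S.A t (x t) with hq
  have hqc : Continuous q := S.hA_C1.continuousOn.comp_continuous hpath hxΩ
  have hqp : Periodic q T := fun t => by simp only [hq, hAp t, hxp t]
  set f : ℝ → LFE.E3 := fun t => -g t + J t (deriv x t) with hf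
  have hfp : Periodic f T := fun t => by
    simp only [hf, hgp t, hJp t, LFE.deriv_periodic hxp t]
  have hfm : AEStronglyMeasurable f volume :=
    hgc.neg.aestronglyMeasurable.add (isBoundedBilinearMap_apply.continuous.comp_aestronglyMeasurable
      (hJc.aestronglyMeasurable.prodMk (measurable_deriv x).aestronglyMeasurable))
  obtain ⟨Mg, -, hMg⟩ := LFE.periodic_norm_bounded hT hgc hgp
  obtain ⟨MJ, hMJ0, hMJ⟩ := LFE.periodic_norm_bounded hT hJc hJp
  have hfM : ∀ t, ‖f t‖ ≤ Mg + MJ * c.toNNReal := fun t => by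
    refine (norm_add_le _ _).trans (add_le_add ((norm_neg _).trans_le (hMg t)) ?_)
    exact (ContinuousLinearMap.le_opNorm _ _).trans
      (mul_le_mul (hMJ t) (norm_deriv_le_of_lipschitz hxL) (norm_nonneg _) hMJ0)
  obtain ⟨l, hl⟩ := LFE.exists_hasDerivAt_velocity hT hc hx1 hfm hfM hfp hqc hqp fun z hz => by
    refine (hcrit z hz).trans_eq ?_
    congr 2
    refine intervalIntegral.integral_congr fun t _ => ?_
    simp only [LFE.dot_eq_inner, LFE.jacT_eq_adjoint, hf, inner_add_left, inner_neg_left]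
    ring
  set u : ℝ → LFE.E3 := fun t => l + (∫ s in (0 : ℝ)..t, f s) - q t with hu
  have hxd : deriv x = fun t => LFE.velocity c (u t) := funext fun t => (hl t).deriv
  have huc : Continuous u := (continuous_const.add (intervalIntegral.continuous_primitive
    (LFE.intervalIntegrable_of_norm_le hfm hfM) 0)).sub hqc
  have hxdc : Continuous (deriv x) := by
    rw [hxd]; exact (LFE.continuous_velocity hc).comp huc
  have hfc : Continuous f := hgc.neg.add (hJc.clm_apply hxdc)
  have hmom : (fun s => (Real.sqrt (1 - ‖deriv x s‖ ^ 2 / c ^ 2))⁻¹ • deriv x s) = u := by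
    funext s
    rw [hxd]
    exact LFE.momentum_velocity hc (u s)
  have hxdiff : ∀ t, HasDerivAt x (deriv x t) t := fun t => (hl t).differentiableAt.hasDerivAt
  have hud : ∀ t, HasDerivAt u (f t - DA (t, x t) (1, deriv x t)) t := fun t =>
    ((hfc.integral_hasStrictDerivAt 0 t).hasDerivAt.const_add l).sub
      (LFE.hasDerivAt_along (hAd t) (hxdiff t))
  rw [hmom]
  refine ⟨fun t _ => ?_, ?_, ?_, fun t => ?_⟩
  · rw [hxd]; exact LFE.norm_velocity_lt hc _
  · exact contDiff_one_iff_deriv.2 ⟨fun t => (hl t).differentiableAt, hxdc⟩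
  · refine contDiff_one_iff_deriv.2 ⟨fun t => (hud t).differentiableAt, ?_⟩
    rw [funext fun t => (hud t).deriv]
    exact hfc.sub (hDAc.clm_apply (continuous_const.prodMk hxdc))
  · convert hud t using 1
    rw [LFE.cross_curl, LFE.jacT_eq_adjoint, hDA, LFE.fderiv_along_eq (hAd t)]
    simp only [hf, hg, hJ]
    abel
end
end

section
/- Assume conditions (V), (AV1) and (AV2) hold. Then c₃ > 0, where c₃ = inf_{A ∈ 𝓕₃} sup_{x ∈ A} I(x) and 𝓕₃ = {A ⊂ Λ : A compact, cat_X(A, Λ) ≥ 3}. -/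
open Filter Topology Set MeasureTheory Function
open scoped ENNReal NNReal

noncomputable section

namespace LFE

/-- Continuity (w.r.t. the `X`-distance) of a homotopy `H : [0,1] × A → (ℝ → E3)`. -/
def XContinuousOn (T : ℝ) (H : ℝ → (ℝ → E3) → (ℝ → E3)) (A : Set (ℝ → E3)) : Prop :=
  ∀ t₀ ∈ Icc (0:ℝ) 1, ∀ x₀ ∈ A, ∀ ε > (0:ℝ), ∃ δ > (0:ℝ),
    ∀ t ∈ Icc (0:ℝ) 1, ∀ x ∈ A,
      |t - t₀| + Xdist T x x₀ < δ → Xdist T (H t x) (H t₀ x₀) < ε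

/-- `A` is contractible in `M` (the inclusion `A ↪ M` is null-homotopic), w.r.t. the
topology of `X`. -/
def XContractibleIn (T : ℝ) (A M : Set (ℝ → E3)) : Prop :=
  ∃ (H : ℝ → (ℝ → E3) → (ℝ → E3)) (p : ℝ → E3), p ∈ M ∧
    XContinuousOn T H A ∧ (∀ x ∈ A, H 0 x = x) ∧ (∀ x ∈ A, H 1 x = p) ∧
    ∀ t ∈ Icc (0:ℝ) 1, ∀ x ∈ A, H t x ∈ M

/-- `C` is (sequentially) closed in `M` w.r.t. the topology of `X`. -/
def XClosedIn (T : ℝ) (C M : Set (ℝ → E3)) : Prop :=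
  ∀ u : ℕ → (ℝ → E3), (∀ n, u n ∈ C) → ∀ y ∈ M,
    Tendsto (fun n => Xdist T (u n) y) atTop (nhds 0) → y ∈ C

/-- `A` is (sequentially) compact w.r.t. the topology of `X`. -/
def XCompact (T : ℝ) (A : Set (ℝ → E3)) : Prop :=
  ∀ u : ℕ → (ℝ → E3), (∀ n, u n ∈ A) → ∃ y ∈ A, ∃ φ : ℕ → ℕ, StrictMono φ ∧
    Tendsto (fun k => Xdist T (u (φ k)) y) atTop (nhds 0)

/-- `A` can be covered by `k` subsets of `M`, closed in `M` and contractible in `M`. -/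
def XCatCover (T : ℝ) (A M : Set (ℝ → E3)) (k : ℕ) : Prop :=
  ∃ As : Fin k → Set (ℝ → E3), (A ⊆ ⋃ i, As i) ∧
    ∀ i, As i ⊆ M ∧ XClosedIn T (As i) M ∧ XContractibleIn T (As i) M

/-- `cat_X(A, M) ≥ j`. -/
def XCatGE (T : ℝ) (A M : Set (ℝ → E3)) (j : ℕ) : Prop :=
  ∀ k : ℕ, XCatCover T A M k → j ≤ k

/-- The set `Λ ⊂ X`, as a set. -/
def LambdaSet (T : ℝ) {N : ℕ} (r : Fin N → ℝ → E3) : Set (ℝ → E3) :=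
  {x | MemLambda T r x}

/-- The family `𝓕_j` of compact subsets of `Λ = D_Φ` of category at least `j` in `Λ`. -/
def Fj (T : ℝ) {N : ℕ} (r : Fin N → ℝ → E3) (j : ℕ) : Set (Set (ℝ → E3)) :=
  {A | A ⊆ LambdaSet T r ∧ XCompact T A ∧ XCatGE T A (LambdaSet T r) j}

/-- The min-max levels `c_j = inf_{A ∈ 𝓕_j} sup_{x ∈ A} I(x)`. -/
def cLevel (T c : ℝ) {N : ℕ} (r : Fin N → ℝ → E3) (V : ℝ → E3 → ℝ) (A : ℝ → E3 → E3)
    (j : ℕ) : EReal :=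
  ⨅ B ∈ Fj T r j, ⨆ x ∈ B, IE T c r V A x

end LFE

namespace LFE

lemma MemX.continuous {x : ℝ → E3} (hx : MemX T x) : Continuous x := by
  obtain ⟨-, K, hK⟩ := hx
  exact hK.continuous

lemma memX_const (p : E3) : MemX T fun _ => p :=
  ⟨fun _ => rfl, 0, LipschitzWith.const p⟩

lemma MemX.add {x y : ℝ → E3} (hx : MemX T x) (hy : MemX T y) :
    MemX T fun t => x t + y t := by
  obtain ⟨hxp, K, hK⟩ := hx
  obtain ⟨hyp, L, hL⟩ := hy
  exact ⟨fun t => by simp only [hxp t, hyp t], K + L, hK.add hL⟩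

lemma MemX.sub {x y : ℝ → E3} (hx : MemX T x) (hy : MemX T y) :
    MemX T fun t => x t - y t := by
  obtain ⟨hxp, K, hK⟩ := hx
  obtain ⟨hyp, L, hL⟩ := hy
  exact ⟨fun t => by simp only [hxp t, hyp t], K + L, hK.sub hL⟩

lemma MemX.smul {x : ℝ → E3} (a : ℝ) (hx : MemX T x) : MemX T fun t => a • x t := by
  obtain ⟨hxp, K, hK⟩ := hx
  exact ⟨fun t => by simp only [hxp t], ‖a‖₊ * K, (lipschitzWith_smul a).comp hK⟩

lemma MemX.norm_le_supN {x : ℝ → E3} (hT : 0 < T) (hx : MemX T x) (t : ℝ) :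
    ‖x t‖ ≤ supN T x := by
  obtain ⟨s, hs, hst⟩ := hx.1.exists_mem_Ico₀ hT t
  rw [hst]
  refine le_csSup ?_ ⟨s, Ico_subset_Icc_self hs, rfl⟩
  exact (isCompact_Icc.image hx.continuous.norm).bddAbove

lemma supN_le {x : ℝ → E3} (hT : 0 < T) {M : ℝ} (h : ∀ t, ‖x t‖ ≤ M) : supN T x ≤ M := by
  refine csSup_le ⟨_, 0, ⟨le_rfl, hT.le⟩, rfl⟩ ?_
  rintro _ ⟨t, -, rfl⟩
  exact h t

lemma MemX.ae_norm_deriv_le_derN {x : ℝ → E3} (hx : MemX T x) :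
    ∀ᵐ t ∂volume.restrict (Icc 0 T), ‖deriv x t‖ ≤ derN T x := by
  obtain ⟨-, K, hK⟩ := hx
  have hfin : eLpNorm (deriv x) ⊤ (volume.restrict (Icc 0 T)) ≠ ⊤ := by
    refine ne_top_of_le_ne_top (ENNReal.coe_ne_top (r := K)) ?_
    rw [eLpNorm_exponent_top]
    refine eLpNormEssSup_le_of_ae_bound (C := (K : ℝ)) ?_ |>.trans ?_
    · exact Eventually.of_forall fun t => norm_deriv_le_of_lipschitz hK
    · simp
  filter_upwards [ae_le_eLpNormEssSup (f := deriv x) (μ := volume.restrict (Icc 0 T))] with t ht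
  rw [← eLpNorm_exponent_top] at ht
  have := ENNReal.toReal_mono hfin ht
  simpa [derN] using this

lemma derN_le {x : ℝ → E3} {M : ℝ} (hM : 0 ≤ M)
    (h : ∀ᵐ t ∂volume.restrict (Icc 0 T), ‖deriv x t‖ ≤ M) : derN T x ≤ M := by
  rw [derN, eLpNorm_exponent_top]
  exact ENNReal.toReal_le_of_le_ofReal hM (eLpNormEssSup_le_of_ae_bound h)

lemma derN_nonneg (T : ℝ) (x : ℝ → E3) : 0 ≤ derN T x := ENNReal.toReal_nonneg

lemma MemX.supN_nonneg {x : ℝ → E3} (hT : 0 < T) (hx : MemX T x) : 0 ≤ supN T x :=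
  (norm_nonneg _).trans (hx.norm_le_supN hT 0)

lemma norm_sub_le_Xdist {x y : ℝ → E3} (hT : 0 < T) (hx : MemX T x) (hy : MemX T y) (t : ℝ) :
    ‖x t - y t‖ ≤ Xdist T x y :=
  ((hx.sub hy).norm_le_supN hT t).trans (le_add_of_nonneg_right (derN_nonneg _ _))

lemma tendsto_of_Xdist {u : ℕ → ℝ → E3} {y : ℝ → E3} (hT : 0 < T) (hu : ∀ n, MemX T (u n))
    (hy : MemX T y) (h : Tendsto (fun n => Xdist T (u n) y) atTop (nhds 0)) (t : ℝ) :
    Tendsto (fun n => u n t) atTop (nhds (y t)) := by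
  rw [tendsto_iff_norm_sub_tendsto_zero]
  exact squeeze_zero (fun _ => norm_nonneg _) (fun n => norm_sub_le_Xdist hT (hu n) hy t) h

lemma MemX.ae_differentiableAt {x : ℝ → E3} (hx : MemX T x) :
    ∀ᵐ t ∂volume.restrict (Icc 0 T), DifferentiableAt ℝ x t := by
  obtain ⟨-, K, hK⟩ := hx
  exact ae_restrict_of_ae hK.ae_differentiableAt

/-- The affine contraction of a loop onto a constant loop. -/
def segmentHomotopy (p : E3) (s : ℝ) (x : ℝ → E3) : ℝ → E3 := fun t => (1 - s) • x t + s • p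

lemma memX_segmentHomotopy {x : ℝ → E3} (p : E3) (s : ℝ) (hx : MemX T x) :
    MemX T (segmentHomotopy p s x) :=
  (hx.smul (1 - s)).add (memX_const (s • p))

lemma Xdist_segmentHomotopy_le {x y : ℝ → E3} (hT : 0 < T) (p : E3) {s s₀ : ℝ}
    (hs : s ∈ Icc (0 : ℝ) 1) (hx : MemX T x) (hy : MemX T y) :
    Xdist T (segmentHomotopy p s x) (segmentHomotopy p s₀ y)
      ≤ Xdist T x y + |s - s₀| * (Xnorm T y + ‖p‖) := by
  have hz := hx.sub hy
  have h1 : |1 - s| ≤ 1 := by rw [abs_le]; constructor <;> linarith [hs.1, hs.2]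
  have hsup : supN T (fun t => segmentHomotopy p s x t - segmentHomotopy p s₀ y t)
      ≤ supN T (fun t => x t - y t) + |s - s₀| * (supN T y + ‖p‖) := by
    refine supN_le hT fun t => ?_
    have : segmentHomotopy p s x t - segmentHomotopy p s₀ y t
        = (1 - s) • (x t - y t) + (s - s₀) • (p - y t) := by
      simp only [segmentHomotopy]; module
    rw [this]
    refine (norm_add_le _ _).trans (add_le_add ?_ ?_)
    · rw [norm_smul, Real.norm_eq_abs]
      exact (mul_le_of_le_one_left (norm_nonneg _) h1).trans (hz.norm_le_supN hT t)
    · rw [norm_smul, Real.norm_eq_abs]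
      refine mul_le_mul_of_nonneg_left ?_ (abs_nonneg _)
      linarith [norm_sub_le p (y t), hy.norm_le_supN hT t]
  have hder : derN T (fun t => segmentHomotopy p s x t - segmentHomotopy p s₀ y t)
      ≤ derN T (fun t => x t - y t) + |s - s₀| * derN T y := by
    refine derN_le (add_nonneg (derN_nonneg _ _)
      (mul_nonneg (abs_nonneg _) (derN_nonneg _ _))) ?_
    filter_upwards [hz.ae_differentiableAt, hy.ae_differentiableAt,
      hz.ae_norm_deriv_le_derN, hy.ae_norm_deriv_le_derN] with t hzt hyt hzn hyn
    have heq : (fun t => segmentHomotopy p s x t - segmentHomotopy p s₀ y t)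
        = fun t => (1 - s) • (x t - y t) + (s - s₀) • (p - y t) := by
      funext t; simp only [segmentHomotopy]; module
    have hd : HasDerivAt (fun t => segmentHomotopy p s x t - segmentHomotopy p s₀ y t)
        ((1 - s) • deriv (fun t => x t - y t) t + (s - s₀) • (-deriv y t)) t := by
      rw [heq]
      exact (hzt.hasDerivAt.const_smul (1 - s)).add
        ((hyt.hasDerivAt.const_sub p).const_smul (s - s₀))
    rw [hd.deriv]
    refine (norm_add_le _ _).trans (add_le_add ?_ ?_)
    · rw [norm_smul, Real.norm_eq_abs]
      exact (mul_le_of_le_one_left (norm_nonneg _) h1).trans hzn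
    · rw [norm_smul, Real.norm_eq_abs, norm_neg]
      exact mul_le_mul_of_nonneg_left hyn (abs_nonneg _)
  simp only [Xdist, Xnorm]
  linarith

lemma xContinuousOn_segmentHomotopy (hT : 0 < T) (p : E3) {C : Set (ℝ → E3)}
    (hC : ∀ x ∈ C, MemX T x) : XContinuousOn T (segmentHomotopy p) C := by
  intro s₀ hs₀ y hy ε hε
  have hM : 0 ≤ Xnorm T y + ‖p‖ :=
    add_nonneg (add_nonneg ((hC y hy).supN_nonneg hT) (derN_nonneg _ _)) (norm_nonneg _)
  refine ⟨ε / (1 + (Xnorm T y + ‖p‖)), by positivity, fun s hs x hx h => ?_⟩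
  refine (Xdist_segmentHomotopy_le hT p hs (hC x hx) (hC y hy)).trans_lt ?_
  rw [lt_div_iff₀ (by positivity)] at h
  have hd : 0 ≤ Xdist T x y := (norm_nonneg _).trans (norm_sub_le_Xdist hT (hC x hx) (hC y hy) 0)
  nlinarith [abs_nonneg (s - s₀), mul_nonneg hd hM]

/-- The `c`-Lipschitz loops in `Λ` starting at distance at least `R` from the origin, in the
half-space `{q | 0 ≤ ⟪e, q⟫}`. -/
def farHalf (T c : ℝ) {N : ℕ} (r : Fin N → ℝ → E3) (R : ℝ) (e : E3) : Set (ℝ → E3) :=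
  {x | MemLambda T r x ∧ LipschitzWith (Real.toNNReal c) x ∧ R ≤ ‖x 0‖ ∧ 0 ≤ inner ℝ e (x 0)}

lemma xClosedIn_farHalf (hT : 0 < T) (r : Fin N → ℝ → E3) (R : ℝ) (e : E3) :
    XClosedIn T (farHalf T c r R e) (LambdaSet T r) := by
  intro u hu y hy h
  have hlim := tendsto_of_Xdist hT (fun n => (hu n).1.1) hy.1 h
  refine ⟨hy, LipschitzWith.of_dist_le_mul fun s t => ?_, ?_, ?_⟩
  · exact le_of_tendsto' ((hlim s).dist (hlim t)) fun n => (hu n).2.1.dist_le_mul s t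
  · exact ge_of_tendsto' (hlim 0).norm fun n => (hu n).2.2.1
  · exact ge_of_tendsto' ((tendsto_const_nhds (x := e)).inner (𝕜 := ℝ) (hlim 0)) fun n => (hu n).2.2.2

lemma half_le_norm_segment {R s : ℝ} {p q : E3} (hR : 0 ≤ R) (hp : R ≤ ‖p‖)
    (hq : R ≤ ‖q‖) (hpq : 0 ≤ inner ℝ p q) (hs : s ∈ Icc (0 : ℝ) 1) :
    R / 2 ≤ ‖(1 - s) • q + s • p‖ := by
  obtain ⟨hs0, hs1⟩ := hs
  refine le_of_sq_le_sq ?_ (norm_nonneg _)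
  rw [norm_add_sq_real, norm_smul, norm_smul, inner_smul_left, inner_smul_right,
    Real.norm_eq_abs, Real.norm_eq_abs, mul_pow, mul_pow, sq_abs, sq_abs, real_inner_comm]
  have h1 : (1 - s) ^ 2 * R ^ 2 ≤ (1 - s) ^ 2 * ‖q‖ ^ 2 := by gcongr
  have h2 : s ^ 2 * R ^ 2 ≤ s ^ 2 * ‖p‖ ^ 2 := by gcongr
  have h3 : 0 ≤ (1 - s) * (s * inner ℝ p q) :=
    mul_nonneg (by linarith) (mul_nonneg hs0 hpq)
  have h4 : 0 ≤ R ^ 2 * (2 * s - 1) ^ 2 := by positivity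
  simp only [conj_trivial]
  nlinarith

lemma dist_zero_le {x : ℝ → E3} (hc : 0 < c) (hx : LipschitzWith (Real.toNNReal c) x)
    {s t : ℝ} (hs : s ∈ Icc (0 : ℝ) T) (ht : t ∈ Icc (0 : ℝ) T) : ‖x s - x t‖ ≤ c * T := by
  have := hx.dist_le_mul s t
  rw [dist_eq_norm, Real.coe_toNNReal _ hc.le, Real.dist_eq] at this
  refine this.trans (mul_le_mul_of_nonneg_left ?_ hc.le)
  rw [abs_le]
  constructor <;> linarith [hs.1, hs.2, ht.1, ht.2]

lemma xContractibleIn_farHalf (hT : 0 < T) (hc : 0 < c) {r : Fin N → ℝ → E3} {ρ : ℝ}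
    (hρ : ∀ i, ∀ t ∈ Icc (0 : ℝ) T, ‖r i t‖ ≤ ρ) {R : ℝ} (hρ0 : 0 ≤ ρ)
    (hR : 2 * (ρ + c * T) < R) {p : E3} (hp : ‖p‖ = R) :
    XContractibleIn T (farHalf T c r R p) (LambdaSet T r) := by
  have hcT : 0 < c * T := mul_pos hc hT
  refine ⟨segmentHomotopy p, fun _ => p, ⟨memX_const p, fun t ht i hi => ?_⟩,
    xContinuousOn_segmentHomotopy hT p fun x hx => hx.1.1, fun x _ => ?_, fun x _ => ?_,
    fun s hs x hx => ⟨memX_segmentHomotopy p s hx.1.1, fun t ht i hi => ?_⟩⟩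
  · have := hρ i t ht
    simp only at hi
    rw [← hi, hp] at this
    linarith
  · funext t; simp [segmentHomotopy]
  · funext t; simp [segmentHomotopy]
  · have h1 := hρ i t ht
    simp only at hi
    rw [← hi] at h1
    have h2 := half_le_norm_segment (by linarith) hp.ge hx.2.2.1 hx.2.2.2 hs
    have h3 : (1 - s) • x 0 + s • p = segmentHomotopy p s x t + (1 - s) • (x 0 - x t) := by
      simp only [segmentHomotopy]; module
    rw [h3] at h2
    have h4 := norm_add_le (segmentHomotopy p s x t) ((1 - s) • (x 0 - x t))
    have h5 : ‖(1 - s) • (x 0 - x t)‖ ≤ c * T := by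
      rw [norm_smul, Real.norm_eq_abs]
      refine (mul_le_of_le_one_left (norm_nonneg _) ?_).trans
        (dist_zero_le hc hx.2.1 ⟨le_rfl, hT.le⟩ ht)
      rw [abs_le]; constructor <;> linarith [hs.1, hs.2]
    linarith

lemma Setting.exists_norm_r_le (S : Setting T c N) :
    ∃ ρ, 0 ≤ ρ ∧ ∀ i, ∀ t ∈ Icc (0 : ℝ) T, ‖S.r i t‖ ≤ ρ := by
  choose b hb using fun i => isCompact_Icc.exists_bound_of_continuousOn
    (s := Icc (0 : ℝ) T) (S.hr_C1 i).continuous.continuousOn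
  refine ⟨∑ i, |b i|, Finset.sum_nonneg fun i _ => abs_nonneg _, fun i t ht => ?_⟩
  exact (hb i t ht).trans ((le_abs_self _).trans
    (Finset.single_le_sum (f := fun i => |b i|) (fun i _ => abs_nonneg _) (Finset.mem_univ i)))

lemma CondV.exists_pos_le_neg {S : Setting T c N} (hV : CondV S) (R : ℝ) :
    ∃ m > 0, ∀ p ∈ Omega N S.r, p.1 ∈ Icc (0 : ℝ) T → ‖p.2‖ ≤ R → m ≤ -S.V p.1 p.2 := by
  obtain ⟨hneg, κ, hκ, δ, hδ, hsing⟩ := hV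
  set K : Set (ℝ × E3) := (Icc (0 : ℝ) T ×ˢ Metric.closedBall (0 : E3) R) ∩
    ⋂ i, {p | δ ≤ ‖p.2 - S.r i p.1‖} with hK
  have hKc : IsCompact K := by
    refine (isCompact_Icc.prod (isCompact_closedBall 0 R)).inter_right
      (isClosed_iInter fun i => isClosed_le continuous_const ?_)
    have := (S.hr_C1 i).continuous
    fun_prop
  have hKΩ : K ⊆ Omega N S.r := fun p hp i hi => by
    have := mem_iInter.1 hp.2 i
    simp only [mem_ofPred_eq, hi, sub_self, norm_zero] at this
    linarith
  obtain ⟨m, hm, hmK⟩ := hKc.exists_forall_le' (f := fun p : ℝ × E3 => -S.V p.1 p.2)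
    (S.hV_C1.continuousOn.mono hKΩ).neg (a := 0) fun p hp => by
      have := hneg p (hKΩ hp); linarith
  refine ⟨min m (κ / δ), lt_min hm (by positivity), fun p hp hpt hpR => ?_⟩
  by_cases h : ∃ i, ‖p.2 - S.r i p.1‖ < δ
  · obtain ⟨i, hi⟩ := h
    have h0 : 0 < ‖p.2 - S.r i p.1‖ := norm_pos_iff.2 (sub_ne_zero.2 (hp i))
    have h1 := hsing i p hp hi
    rw [neg_div] at h1
    have h2 : κ / δ ≤ κ / ‖p.2 - S.r i p.1‖ := by gcongr
    exact (min_le_right _ _).trans (by linarith)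
  · push Not at h
    exact (min_le_left _ _).trans
      (hmK p ⟨⟨hpt, by simpa using hpR⟩, mem_iInter.2 h⟩)

lemma continuousOn_prodMk_of_memLambda {r : Fin N → ℝ → E3} {x : ℝ → E3}
    {Y : Type*} [TopologicalSpace Y] {F : ℝ → E3 → Y}
    (hF : ContinuousOn (fun p : ℝ × E3 => F p.1 p.2) (Omega N r)) (hx : MemLambda T r x) :
    ContinuousOn (fun t => F t (x t)) (Icc 0 T) :=
  hF.comp (f := fun t => (t, x t))
    (continuous_id.prodMk hx.1.continuous).continuousOn hx.2

lemma intervalIntegrable_phi (S : Setting T c N) {x : ℝ → E3} (hx : MemLambda T S.r x)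
    (hL : LipschitzWith (Real.toNNReal c) x) :
    IntervalIntegrable (fun t => -(S.V t (x t)) + dot (S.A t (x t)) (deriv x t)) volume 0 T := by
  have hV := continuousOn_prodMk_of_memLambda S.hV_C1.continuousOn hx
  have hA := continuousOn_prodMk_of_memLambda S.hA_C1.continuousOn hx
  rw [intervalIntegrable_iff_integrableOn_Icc_of_le S.hT.le]
  refine hV.neg.integrableOn_Icc.add ?_
  refine Integrable.mono' (g := fun t => ‖S.A t (x t)‖ * c)
    (hA.norm.mul continuousOn_const).integrableOn_Icc ?_ (Eventually.of_forall fun t => ?_)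
  · simp only [dot_eq_inner]
    exact (hA.aestronglyMeasurable measurableSet_Icc).inner
      (stronglyMeasurable_deriv x).aestronglyMeasurable
  · rw [dot_eq_inner]
    refine (norm_inner_le_norm _ _).trans (mul_le_mul_of_nonneg_left ?_ (norm_nonneg _))
    simpa [S.hc.le] using norm_deriv_le_of_lipschitz (x₀ := t) hL

lemma psiVal_nonneg (hT : 0 < T) (x : ℝ → E3) : 0 ≤ psiVal T c x := by
  refine intervalIntegral.integral_nonneg hT.le fun t _ => mul_nonneg (sq_nonneg c) ?_
  rw [sub_nonneg, Real.sqrt_le_one]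
  have : 0 ≤ ‖deriv x t‖ ^ 2 / c ^ 2 := by positivity
  linarith

lemma le_phiVal (S : Setting T c N) {κ' m : ℝ} (hκ1 : κ' < 1)
    (hA : ∀ p ∈ Omega N S.r, ‖S.A p.1 p.2‖ ≤ -(κ' / c) * S.V p.1 p.2)
    {x : ℝ → E3} (hx : MemLambda T S.r x) (hL : LipschitzWith (Real.toNNReal c) x)
    (hm : ∀ t ∈ Icc (0 : ℝ) T, m ≤ -S.V t (x t)) :
    T * ((1 - κ') * m) ≤ phiVal T S.V S.A x := by
  have h := intervalIntegral.integral_mono_on S.hT.le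
    (intervalIntegrable_const (c := (1 - κ') * m) (μ := volume))
    (intervalIntegrable_phi S hx hL) fun t ht => ?_
  · rwa [intervalIntegral.integral_const, sub_zero, smul_eq_mul] at h
  have h1 := hA _ (hx.2 t ht)
  have h2 : ‖deriv x t‖ ≤ c := by
    simpa [S.hc.le] using norm_deriv_le_of_lipschitz (x₀ := t) hL
  have h3 := abs_real_inner_le_norm (S.A t (x t)) (deriv x t)
  have h4 : ‖S.A t (x t)‖ * ‖deriv x t‖ ≤ -κ' * S.V t (x t) := by
    calc ‖S.A t (x t)‖ * ‖deriv x t‖ ≤ (-(κ' / c) * S.V t (x t)) * c := by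
          have := norm_nonneg (S.A t (x t))
          exact mul_le_mul h1 h2 (norm_nonneg _) (this.trans h1)
      _ = -κ' * S.V t (x t) := by
          have := S.hc.ne'
          field_simp
  have h5 := neg_abs_le (inner ℝ (S.A t (x t)) (deriv x t))
  rw [dot_eq_inner]
  have h6 : (1 - κ') * m ≤ (1 - κ') * (-S.V t (x t)) :=
    mul_le_mul_of_nonneg_left (hm t ht) (by linarith)
  linarith

lemma exists_lt_IE_of_norm_lt {S : Setting T c N} (hV : CondV S) (hA : CondAV1 S) (R : ℝ) :
    ∃ ε > (0 : ℝ), ∀ x, MemLambda T S.r x → IE T c S.r S.V S.A x < ε →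
      LipschitzWith (Real.toNNReal c) x ∧ R ≤ ‖x 0‖ := by
  obtain ⟨κ', -, hκ1, hA⟩ := hA
  obtain ⟨m, hm, hmV⟩ := hV.exists_pos_le_neg (R + c * T)
  refine ⟨T * ((1 - κ') * m), mul_pos S.hT (mul_pos (by linarith) hm), fun x hx hI => ?_⟩
  by_cases hD : MemDpsi T c x
  · refine ⟨hD.2, ?_⟩
    by_contra! hR
    have hI' : psiVal T c x + phiVal T S.V S.A x < T * ((1 - κ') * m) := by
      simp only [IE, psiE, phiE, if_pos hD, if_pos hx] at hI
      exact_mod_cast hI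
    have hle := le_phiVal S hκ1 hA hx hD.2 (m := m) fun t ht => by
      refine hmV (t, x t) (hx.2 t ht) ht ?_
      have h1 := dist_zero_le S.hc hD.2 ht (left_mem_Icc.2 S.hT.le)
      have h2 := norm_sub_norm_le (x t) (x 0)
      simp only
      linarith
    linarith [psiVal_nonneg (c := c) S.hT x]
  · simp only [IE, psiE, phiE, if_neg hD, if_pos hx, EReal.top_add_coe] at hI
    exact absurd hI not_top_lt

end LFE

/-- **Lemma.** Under (V), (AV1), (AV2), the min-max level `c₃` is strictly positive. -/
theorem third_minmax_level_positive
    {T c : ℝ} {N : ℕ} (S : LFE.Setting T c N)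
    (hV : LFE.CondV S) (hAV1 : LFE.CondAV1 S) (hAV2 : LFE.CondAV2 S) :
    (0 : EReal) < LFE.cLevel T c S.r S.V S.A 3 := by
  obtain ⟨ρ, hρ0, hρ⟩ := S.exists_norm_r_le
  set R : ℝ := 2 * (ρ + c * T) + 1 with hRdef
  have hR0 : 0 ≤ R := by
    have := mul_pos S.hc S.hT
    positivity
  obtain ⟨ε, hε, hfar⟩ := LFE.exists_lt_IE_of_norm_lt hV hAV1 R
  refine (EReal.coe_pos.2 hε).trans_le (le_iInf₂ fun B hB => ?_)
  by_contra! hlt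
  obtain ⟨hBΛ, -, hcat⟩ := hB
  set p : LFE.E3 := EuclideanSpace.single 0 R with hp
  have hpn : ‖p‖ = R := by simp [hp, abs_of_nonneg hR0]
  have hcover : LFE.XCatCover T B (LFE.LambdaSet T S.r) 2 := by
    refine ⟨![LFE.farHalf T c S.r R p, LFE.farHalf T c S.r R (-p)], fun x hx => ?_, fun i => ?_⟩
    · obtain ⟨hL, hxR⟩ := hfar x (hBΛ hx)
        ((le_iSup₂ (f := fun x _ => LFE.IE T c S.r S.V S.A x) x hx).trans_lt hlt)
      rw [mem_iUnion]
      rcases le_total 0 (inner ℝ p (x 0)) with h | h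
      · exact ⟨0, hBΛ hx, hL, hxR, h⟩
      · exact ⟨1, hBΛ hx, hL, hxR, by rw [inner_neg_left]; linarith⟩
    · have key : ∀ q : LFE.E3, ‖q‖ = R → LFE.farHalf T c S.r R q ⊆ LFE.LambdaSet T S.r ∧
          LFE.XClosedIn T (LFE.farHalf T c S.r R q) (LFE.LambdaSet T S.r) ∧
          LFE.XContractibleIn T (LFE.farHalf T c S.r R q) (LFE.LambdaSet T S.r) :=
        fun q hq => ⟨fun x hx => hx.1, LFE.xClosedIn_farHalf S.hT S.r R q,
          LFE.xContractibleIn_farHalf S.hT S.hc hρ hρ0 (by linarith) hq⟩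
      fin_cases i
      · exact key p hpn
      · exact key (-p) (by rw [norm_neg, hpn])
  have := hcat 2 hcover
  omega
end
end
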